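/- (i) There exists a constant c > 0 such that for all 0 < η ≤ 1/2, all α ∈ ℝ, and all r ∈ 𝕋³: ∫_{𝕋³} dp / ( |α − e(p) + iη| · |||p − r||| ) ≤ c |log η|³. (ii) For every κ > 0 there exist c > 0 and λ₀ ∈ (0,1) (depending only on κ) such that for all 0 < λ ≤ λ₀, with η := λ^{2+κ}, all α ∈ ℝ, and all r ∈ 𝕋³: ∫_{𝕋³} dp / ( |α − ω(p) + iη| · |||p − r||| ) ≤ c η^{−κ/2} |log η|³. -/

import Mathlib

open MeasureTheory Filter Topology

noncomputable section

/-- The torus `𝕋³ = [-1/2, 1/2]³` realized as a box in `ℝ³`. -/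
def T3 : Set (Fin 3 → ℝ) := Set.pi Set.univ fun _ => Set.Icc (-(1/2) : ℝ) (1/2)

/-- The lattice dispersion relation `e(p) = ∑_j (1 - cos(2π p_j))`. -/
def edisp (p : Fin 3 → ℝ) : ℝ := ∑ j, (1 - Real.cos (2 * Real.pi * p j))

/-- `Θ_ε(α) = ∫_{𝕋³} dq / (α - e(q) + iε)`. -/
def ThetaEps (ε α : ℝ) : ℂ := ∫ q in T3, ((α : ℂ) - (edisp q : ℂ) + (ε : ℂ) * Complex.I)⁻¹

/-- `Θ` is the limit of `Θ_ε` as `ε → 0⁺`. -/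
def IsThetaLimit (Θ : ℝ → ℂ) : Prop :=
  ∀ α : ℝ, Tendsto (fun ε => ThetaEps ε α) (𝓝[>] (0 : ℝ)) (𝓝 (Θ α))

/-- The renormalized dispersion `ω(p) = e(p) + λ² Θ(e(p))`. -/
def omegaR (Θ : ℝ → ℂ) (lam : ℝ) (p : Fin 3 → ℝ) : ℂ :=
  (edisp p : ℂ) + (lam : ℂ) ^ 2 * Θ (edisp p)

/-- A function on `𝕋³`, i.e. a `ℤ³`-periodic function on `ℝ³`. -/
def ZPeriodic (g : (Fin 3 → ℝ) → ℂ) : Prop :=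
  ∀ (p : Fin 3 → ℝ) (n : Fin 3 → ℤ), g (p + fun j => (n j : ℝ)) = g p

/-- The `C¹` norm `‖g‖_∞ + ‖∇g‖_∞`. -/
def C1Norm (g : (Fin 3 → ℝ) → ℂ) : ℝ :=
  (⨆ p : Fin 3 → ℝ, ‖g p‖) + ⨆ p : Fin 3 → ℝ, ‖fderiv ℝ g p‖

/-- `|||α||| = min {|α|, |α-2|, |α-3|, |α-4|, |α-6|}`. -/
def anorm (a : ℝ) : ℝ := min (min (min |a| |a - 2|) (min |a - 3| |a - 4|)) |a - 6|

/-- Distance between two points of the circle `ℝ/ℤ`. -/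
def cdist (x y : ℝ) : ℝ := |x - y - (round (x - y) : ℝ)|

/-- `|||q||| = η + min {dist(q, γ) : γ a critical point of e}` (torus distance);
the critical points are exactly the points with all coordinates in `{0, 1/2}` mod `1`,
and minimizing over them coordinatewise gives the formula below. -/
def tnorm (η : ℝ) (q : Fin 3 → ℝ) : ℝ :=
  η + Real.sqrt (∑ j, (min (cdist (q j) 0) (cdist (q j) (1/2))) ^ 2)

/-- `|∇e(q)|`, the Euclidean length of the gradient of the dispersion relation. -/
def gradNorm (q : Fin 3 → ℝ) : ℝ := Real.sqrt (∑ j, (2 * Real.pi * Real.sin (2 * Real.pi * q j)) ^ 2)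

lemma key_unit (a x : ℝ) (hx0 : 0 ≤ x) (hx1 : x ≤ 1/2) :
    ∀ y : ℝ, 0 ≤ y → y ≤ 1/2 → a = Real.cos (2 * Real.pi * y) →
    8 * |x - y| ^ 2 ≤ |a - Real.cos (2 * Real.pi * x)| ∧
    2 * Real.sqrt |(1 - |a|)| * |x - y| ≤ |a - Real.cos (2 * Real.pi * x)| := by
  intro y hy0 hy1 ha
  have hpi := Real.pi_pos
  have sx : 0 ≤ Real.sin (Real.pi * x) :=
    Real.sin_nonneg_of_nonneg_of_le_pi (by positivity) (by nlinarith)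
  have sy : 0 ≤ Real.sin (Real.pi * y) :=
    Real.sin_nonneg_of_nonneg_of_le_pi (by positivity) (by nlinarith)
  have cx : 0 ≤ Real.cos (Real.pi * x) :=
    Real.cos_nonneg_of_neg_pi_div_two_le_of_le (by nlinarith) (by nlinarith)
  have cy : 0 ≤ Real.cos (Real.pi * y) :=
    Real.cos_nonneg_of_neg_pi_div_two_le_of_le (by nlinarith) (by nlinarith)
  have px := Real.sin_sq_add_cos_sq (Real.pi * x)
  have py := Real.sin_sq_add_cos_sq (Real.pi * y)
  have hsub : 2 * |x - y| ≤ |Real.sin (Real.pi * (x - y))| := by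
    have h := Real.mul_abs_le_abs_sin (x := Real.pi * (x - y)) (by
      rw [abs_mul, abs_of_pos hpi]
      have : |x - y| ≤ 1/2 := abs_le.2 ⟨by linarith, by linarith⟩
      nlinarith)
    rw [abs_mul, abs_of_pos hpi] at h
    calc 2 * |x - y| = 2 / Real.pi * (Real.pi * |x - y|) := by field_simp
      _ ≤ _ := h
  have hdiff : a - Real.cos (2 * Real.pi * x) =
      2 * Real.sin (Real.pi * (x + y)) * Real.sin (Real.pi * (x - y)) := by
    have e1 : 2 * Real.pi * x = 2 * (Real.pi * x) := by ring
    have e2 : 2 * Real.pi * y = 2 * (Real.pi * y) := by ring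
    rw [ha, e1, e2, mul_add, mul_sub, Real.sin_add, Real.sin_sub, Real.cos_two_mul, Real.cos_two_mul]
    nlinarith
  have hadd : Real.sin (Real.pi * (x + y)) =
      Real.sin (Real.pi * x) * Real.cos (Real.pi * y) + Real.cos (Real.pi * x) * Real.sin (Real.pi * y) := by
    rw [mul_add, Real.sin_add]
  have hadd0 : 0 ≤ Real.sin (Real.pi * (x + y)) := by rw [hadd]; positivity
  have hcmp : |Real.sin (Real.pi * (x - y))| ≤ Real.sin (Real.pi * (x + y)) := by
    rw [hadd, mul_sub, Real.sin_sub]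
    have h1 := mul_nonneg sx cy
    have h2 := mul_nonneg cx sy
    exact abs_le.2 ⟨by linarith, by linarith⟩
  have hN : |a - Real.cos (2 * Real.pi * x)| =
      2 * Real.sin (Real.pi * (x + y)) * |Real.sin (Real.pi * (x - y))| := by
    rw [hdiff, abs_mul, abs_mul, abs_of_nonneg hadd0]; norm_num
  have hE := abs_nonneg (x - y)
  have ha2 : a = 2 * Real.cos (Real.pi * y) ^ 2 - 1 := by
    rw [ha, ← Real.cos_two_mul]; congr 1; ring
  have hD : Real.sqrt |(1 - |a|)| ≤ 2 * Real.sin (Real.pi * (x + y)) := by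
    rw [Real.sqrt_le_left (by positivity)]
    have hal : |a| ≤ 1 := by rw [ha]; exact Real.abs_cos_le_one _
    rw [abs_of_nonneg (by linarith), hadd]
    set s := Real.sin (Real.pi * y)
    set c := Real.cos (Real.pi * y)
    set s' := Real.sin (Real.pi * x)
    set c' := Real.cos (Real.pi * x)
    have hab := le_abs_self a
    have hab' := neg_abs_le a
    have h1 : 0 ≤ s' * c' * (s * c) := by positivity
    rcases le_total s c with h | h
    · have : s ^ 2 ≤ (s' * c + c' * s) ^ 2 := by nlinarith [mul_nonneg (sq_nonneg s') (by nlinarith : (0:ℝ) ≤ c^2 - s^2)]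
      nlinarith
    · have : c ^ 2 ≤ (s' * c + c' * s) ^ 2 := by nlinarith [mul_nonneg (sq_nonneg c') (by nlinarith : (0:ℝ) ≤ s^2 - c^2)]
      nlinarith
  rw [hN]
  constructor
  · nlinarith [abs_nonneg (Real.sin (Real.pi * (x - y)))]
  · calc 2 * Real.sqrt |(1 - |a|)| * |x - y| = Real.sqrt |(1 - |a|)| * (2 * |x - y|) := by ring
      _ ≤ _ := by gcongr

/-- basic two-sided geometry of the cosine -/
lemma key1 (a : ℝ) : ∃ y : ℝ, 0 ≤ y ∧ y ≤ 1/2 ∧ ∀ x : ℝ, 0 ≤ x → x ≤ 1/2 →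
    8 * |x - y| ^ 2 ≤ |a - Real.cos (2 * Real.pi * x)| ∧
    2 * Real.sqrt |(1 - |a|)| * |x - y| ≤ |a - Real.cos (2 * Real.pi * x)| ∧
    (Real.sqrt |(1 - |a|)| ≤ 1 ∨ Real.sqrt |(1 - |a|)| ^ 2 ≤ |a - Real.cos (2 * Real.pi * x)|) := by
  have hpi := Real.pi_pos
  have main : ∀ b y x : ℝ, 0 ≤ x → x ≤ 1/2 → 0 ≤ y → y ≤ 1/2 → b = Real.cos (2 * Real.pi * y) →
      |b| = 1 → |a| = 1 + |a - b| →
      |a - Real.cos (2 * Real.pi * x)| = |a - b| + |b - Real.cos (2 * Real.pi * x)| →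
      8 * |x - y| ^ 2 ≤ |a - Real.cos (2 * Real.pi * x)| ∧
    2 * Real.sqrt |(1 - |a|)| * |x - y| ≤ |a - Real.cos (2 * Real.pi * x)| ∧
    (Real.sqrt |(1 - |a|)| ≤ 1 ∨ Real.sqrt |(1 - |a|)| ^ 2 ≤ |a - Real.cos (2 * Real.pi * x)|) := by
    intro b y x hx0 hx1 hy0 hy1 hb hb1 hab hsum
    have h := (key_unit b x hx0 hx1 y hy0 hy1 hb).1
    have hD : Real.sqrt |(1 - |a|)| ^ 2 = |a - b| := by
      rw [Real.sq_sqrt (abs_nonneg _), hab]; simp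
    have := abs_nonneg (a - b)
    refine ⟨by linarith, ?_, Or.inr ?_⟩
    · nlinarith [sq_nonneg (Real.sqrt |(1 - |a|)| - |x - y|), sq_nonneg |x - y|]
    · rw [hD, hsum]; linarith [abs_nonneg (b - Real.cos (2 * Real.pi * x))]
  rcases le_or_gt a (-1) with h | h
  · refine ⟨1/2, by norm_num, by norm_num, fun x hx0 hx1 => ?_⟩
    have hc := Real.neg_one_le_cos (2 * Real.pi * x)
    refine main (-1) (1/2) x hx0 hx1 (by norm_num) (by norm_num) ?_ (by norm_num) ?_ ?_
    · rw [show 2 * Real.pi * (1/2) = Real.pi by ring, Real.cos_pi]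
    · rw [abs_of_nonpos (by linarith), abs_of_nonpos (by linarith)]; ring
    · rw [abs_of_nonpos (by linarith), abs_of_nonpos (by linarith), abs_of_nonpos (by linarith)]; ring
  rcases le_or_gt 1 a with h' | h'
  · refine ⟨0, by norm_num, by norm_num, fun x hx0 hx1 => ?_⟩
    have hc := Real.cos_le_one (2 * Real.pi * x)
    refine main 1 0 x hx0 hx1 (by norm_num) (by norm_num) (by simp) (by norm_num) ?_ ?_
    · rw [abs_of_nonneg (by linarith), abs_of_nonneg (by linarith)]; ring
    · rw [abs_of_nonneg (by linarith), abs_of_nonneg (by linarith), abs_of_nonneg (by linarith)]; ring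
  · have h0 : 0 ≤ Real.arccos a / (2 * Real.pi) := div_nonneg (Real.arccos_nonneg a) (by positivity)
    have h1 : Real.arccos a / (2 * Real.pi) ≤ 1/2 := by
      rw [div_le_iff₀ (by positivity)]; linarith [Real.arccos_le_pi a]
    refine ⟨_, h0, h1, fun x hx0 hx1 => ?_⟩
    have hk := key_unit a x hx0 hx1 _ h0 h1 (by
      rw [mul_div_cancel₀ _ (by positivity), Real.cos_arccos h.le h'.le])
    refine ⟨hk.1, hk.2, Or.inl ?_⟩
    apply Real.sqrt_le_one.2
    have : |a| < 1 := abs_lt.2 ⟨h, h'⟩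
    rw [abs_of_nonneg (by linarith)]
    linarith [abs_nonneg a]

lemma cos_abs_arg (x : ℝ) : Real.cos (2 * Real.pi * |x|) = Real.cos (2 * Real.pi * x) := by
  rcases abs_choice x with h | h <;> rw [h]
  rw [mul_neg, Real.cos_neg]

lemma key2 (a : ℝ) : ∃ y : ℝ, 0 ≤ y ∧ y ≤ 1/2 ∧ ∀ x ∈ Set.Icc (-(1/2) : ℝ) (1/2), ∀ η : ℝ, 0 < η → η ≤ 1/2 →
    (Real.sqrt |(1 - |a|)| + Real.sqrt η) * (η + |(|x| - y)|) ≤ 3 * (|a - Real.cos (2 * Real.pi * x)| + η) ∧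
    (η + |(|x| - y)|) ^ 2 ≤ |a - Real.cos (2 * Real.pi * x)| + η := by
  obtain ⟨y, h0, h1, hy⟩ := key1 a
  refine ⟨y, h0, h1, fun x hx η hη hη1 => ?_⟩
  obtain ⟨k1, k2, k3⟩ := hy |x| (abs_nonneg x) (abs_le.2 ⟨by linarith [hx.1], hx.2⟩)
  rw [cos_abs_arg] at k1 k2 k3
  set N := |a - Real.cos (2 * Real.pi * x)|
  set D := Real.sqrt |(1 - |a|)|
  have hD : 0 ≤ D := Real.sqrt_nonneg _
  set E := |(|x| - y)|
  have hE : 0 ≤ E := abs_nonneg _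
  have hN : 0 ≤ N := abs_nonneg _
  have hh : Real.sqrt η ^ 2 = η := Real.sq_sqrt hη.le
  have hh0 : 0 ≤ Real.sqrt η := Real.sqrt_nonneg _
  have hh1 : Real.sqrt η ≤ 1 := Real.sqrt_le_one.2 (by linarith)
  set h := Real.sqrt η
  constructor
  · have t1 : h * E ≤ (η + N / 8) / 2 := by nlinarith [sq_nonneg (h - E)]
    have t2 : D * η ≤ η + N := by
      rcases k3 with k | k
      · nlinarith
      · rcases le_total D 1 with k' | k'
        · nlinarith
        · nlinarith
    have t3 : h * η ≤ η := by nlinarith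
    nlinarith
  · nlinarith [sq_nonneg (η - E)]

lemma sqrt_ge_of_sq {D η h u : ℝ} (hη : 0 < η) (hD : D = h) (hle : u ^ 2 ≤ |h| + η) :
    u ≤ Real.sqrt |D| + Real.sqrt η := by
  subst hD
  have h1 := Real.sq_sqrt (abs_nonneg D)
  have h2 := Real.sq_sqrt hη.le
  have h3 := Real.sqrt_nonneg |D|
  have h4 := Real.sqrt_nonneg η
  apply abs_le_of_sq_le_sq' _ (by positivity) |>.2
  nlinarith [mul_nonneg h3 h4]

/-- lower bound on the distance to the thresholds -/
lemma key3 (u : ℝ) : ∃ y y' : ℝ, (0 ≤ y ∧ y ≤ 1/2) ∧ (0 ≤ y' ∧ y' ≤ 1/2) ∧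
    ∀ x ∈ Set.Icc (-(1/2) : ℝ) (1/2), ∀ η : ℝ, 0 < η → η ≤ 1/2 →
    (η + |(|x| - y)| ≤ Real.sqrt |(1 - |u - Real.cos (2 * Real.pi * x)|)| + Real.sqrt η) ∨
    (η + |(|x| - y')| ≤ Real.sqrt |(1 - |u - Real.cos (2 * Real.pi * x)|)| + Real.sqrt η) := by
  obtain ⟨y, h0, h1, hy⟩ := key2 (u - 1)
  obtain ⟨y', h0', h1', hy'⟩ := key2 (u + 1)
  refine ⟨y, y', ⟨h0, h1⟩, ⟨h0', h1'⟩, fun x hx η hη hη1 => ?_⟩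
  have k := (hy x hx η hη hη1).2
  have k' := (hy' x hx η hη hη1).2
  rcases le_total 0 (u - Real.cos (2 * Real.pi * x)) with h | h
  · left
    refine sqrt_ge_of_sq (h := -(u - 1 - Real.cos (2 * Real.pi * x))) hη ?_ ?_
    · rw [abs_of_nonneg h]; ring
    · rwa [abs_neg]
  · right
    refine sqrt_ge_of_sq (h := (u + 1 - Real.cos (2 * Real.pi * x))) hη ?_ k'
    rw [abs_of_nonpos h]; ring

lemma lint_shift (g G : ℝ → ℝ) (hg : ∀ u, 0 ≤ u → 0 ≤ g u) (hc : ContinuousOn g (Set.Ici 0))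
    (hG : ∀ u, 0 ≤ u → HasDerivAt G (g u) u) (z : ℝ) (hz : |z| ≤ 1) :
    (∫⁻ x in Set.Icc (-(1/2) : ℝ) (1/2), ENNReal.ofReal (g |x - z|)) ≤
      ENNReal.ofReal (2 * (G 2 - G 0)) := by
  have hz' := abs_le.1 hz
  have hcont : Continuous (fun u : ℝ => g |u|) :=
    hc.comp_continuous continuous_abs (fun x => abs_nonneg x)
  have hpos : ∫ u in (0:ℝ)..2, g |u| = G 2 - G 0 := by
    have : ∫ u in (0:ℝ)..2, g u = G 2 - G 0 := by
      apply intervalIntegral.integral_eq_sub_of_hasDerivAt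
      · intro x hx; rw [Set.uIcc_of_le (by norm_num)] at hx; exact hG x hx.1
      · apply ContinuousOn.intervalIntegrable
        rw [Set.uIcc_of_le (by norm_num)]
        exact hc.mono (fun x hx => hx.1)
    rw [← this]
    apply intervalIntegral.integral_congr
    intro x hx; rw [Set.uIcc_of_le (by norm_num)] at hx
    simp only [abs_of_nonneg hx.1]
  have hneg : ∫ u in (-2:ℝ)..0, g |u| = G 2 - G 0 := by
    rw [← hpos]
    have := intervalIntegral.integral_comp_neg (a := 0) (b := 2) (fun u : ℝ => g |u|)
    simp only [abs_neg, neg_zero] at this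
    exact this.symm
  have htot : ∫ u in (-2:ℝ)..2, g |u| = 2 * (G 2 - G 0) := by
    rw [← intervalIntegral.integral_add_adjacent_intervals (b := 0)
      (hcont.intervalIntegrable _ _) (hcont.intervalIntegrable _ _), hpos, hneg]; ring
  have hle : ∫ x in (-(1/2) : ℝ)..(1/2), g |x - z| ≤ 2 * (G 2 - G 0) := by
    rw [intervalIntegral.integral_comp_sub_right (fun u => g |u|), ← htot]
    apply intervalIntegral.integral_mono_interval (by linarith) (by linarith) (by linarith)
    · exact Filter.Eventually.of_forall (fun x => hg _ (abs_nonneg x))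
    · exact hcont.intervalIntegrable _ _
  rw [← ofReal_integral_eq_lintegral_ofReal]
  · apply ENNReal.ofReal_le_ofReal
    rw [integral_Icc_eq_integral_Ioc, ← intervalIntegral.integral_of_le (by norm_num)]
    exact hle
  · exact (hcont.comp (continuous_id.sub continuous_const)).continuousOn.integrableOn_Icc
  · exact Filter.Eventually.of_forall (fun x => hg _ (abs_nonneg _))

lemma lint_abs (g : ℝ → ℝ) (A : ℝ) (hA : 0 ≤ A)
    (hm : Continuous (fun u : ℝ => g |u|))
    (h : ∀ z : ℝ, |z| ≤ 1 →
      (∫⁻ x in Set.Icc (-(1/2) : ℝ) (1/2), ENNReal.ofReal (g |x - z|)) ≤ ENNReal.ofReal A)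
    (y : ℝ) (h0 : 0 ≤ y) (h1 : y ≤ 1/2) :
    (∫⁻ x in Set.Icc (-(1/2) : ℝ) (1/2), ENNReal.ofReal (g |(|x| - y)|)) ≤ ENNReal.ofReal (2 * A) := by
  calc _ ≤ ∫⁻ x in Set.Icc (-(1/2) : ℝ) (1/2),
        (ENNReal.ofReal (g |x - y|) + ENNReal.ofReal (g |x - (-y)|)) := by
        apply lintegral_mono
        intro x
        rcases abs_choice x with h | h
        · simp only [h]; exact le_self_add
        · simp only [h]
          rw [show -x - y = -(x - -y) by ring, abs_neg]
          exact le_add_self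
    _ = _ := lintegral_add_left (by
        have : Continuous fun x : ℝ => g |x - y| := hm.comp (continuous_id.sub continuous_const)
        exact this.measurable.ennreal_ofReal) _
    _ ≤ ENNReal.ofReal A + ENNReal.ofReal A := by
        gcongr
        · exact h y (abs_le.2 ⟨by linarith, by linarith⟩)
        · exact h (-y) (abs_le.2 ⟨by linarith, by linarith⟩)
    _ = _ := by rw [← ENNReal.ofReal_add hA hA]; ring_nf

lemma half_log {η : ℝ} (hη : 0 < η) (hη1 : η ≤ 1/2) : Real.log 2 ≤ |Real.log η| := by
  have : Real.log η ≤ Real.log (1/2) := Real.log_le_log hη hη1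
  rw [one_div, Real.log_inv] at this
  have h2 := Real.log_pos (by norm_num : (1:ℝ) < 2)
  rw [abs_of_nonpos (by linarith)]; linarith

lemma lint_one {η : ℝ} (hη : 0 < η) (hη1 : η ≤ 1/2) (z : ℝ) (hz : |z| ≤ 1) :
    (∫⁻ x in Set.Icc (-(1/2) : ℝ) (1/2), ENNReal.ofReal ((η + |x - z|)⁻¹)) ≤
      ENNReal.ofReal (6 * |Real.log η|) := by
  refine (lint_shift (fun u => (η + u)⁻¹) (fun u => Real.log (η + u)) ?_ ?_ ?_ z hz).trans ?_
  · intro u hu; positivity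
  · apply ContinuousOn.inv₀ (by fun_prop)
    intro x hx; have : 0 ≤ x := hx
    positivity
  · intro u hu
    have := ((hasDerivAt_id u).const_add η).log (by simp; positivity)
    simpa using this
  · apply ENNReal.ofReal_le_ofReal
    have h1 := half_log hη hη1
    have h2 : Real.log (η + 2) ≤ Real.log (2 ^ 2) := Real.log_le_log (by linarith) (by linarith)
    rw [Real.log_pow] at h2
    have h3 := neg_abs_le (Real.log η)
    push_cast at h2
    simp only [add_zero]
    linarith

lemma cont_one {η : ℝ} (hη : 0 < η) : Continuous (fun u : ℝ => (η + |u|)⁻¹) := by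
  apply Continuous.inv₀ (by fun_prop)
  intro x; positivity

lemma lint_one_abs {η : ℝ} (hη : 0 < η) (hη1 : η ≤ 1/2) (y : ℝ) (h0 : 0 ≤ y) (h1 : y ≤ 1/2) :
    (∫⁻ x in Set.Icc (-(1/2) : ℝ) (1/2), ENNReal.ofReal ((η + |(|x| - y)|)⁻¹)) ≤
      ENNReal.ofReal (12 * |Real.log η|) := by
  have := lint_abs (fun u => (η + u)⁻¹) (6 * |Real.log η|) (by positivity)
    (cont_one hη) (fun z hz => lint_one hη hη1 z hz) y h0 h1
  convert this using 2; ring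

lemma lint_34 {η : ℝ} (hη : 0 < η) (hη1 : η ≤ 1/2) (z : ℝ) (hz : |z| ≤ 1) :
    (∫⁻ x in Set.Icc (-(1/2) : ℝ) (1/2), ENNReal.ofReal ((η + |x - z|) ^ (-(3/4) : ℝ))) ≤
      ENNReal.ofReal 24 := by
  refine (lint_shift (fun u => (η + u) ^ (-(3/4) : ℝ)) (fun u => 4 * (η + u) ^ ((1/4) : ℝ)) ?_ ?_ ?_ z hz).trans ?_
  · intro u hu; positivity
  · apply ContinuousOn.rpow_const (by fun_prop)
    intro x hx; have : 0 ≤ x := hx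
    left; positivity
  · intro u hu
    have := (((hasDerivAt_id u).const_add η).rpow_const (p := 1/4) (Or.inl (by simp; positivity))).const_mul 4
    simp only [id] at this
    refine this.congr_deriv ?_
    norm_num
    ring
  · apply ENNReal.ofReal_le_ofReal
    have h2 : (η + 2) ^ ((1/4) : ℝ) ≤ 3 := by
      calc (η + 2) ^ ((1/4) : ℝ) ≤ (η + 2) ^ (1 : ℝ) :=
            Real.rpow_le_rpow_of_exponent_le (by linarith) (by norm_num)
        _ ≤ 3 := by rw [Real.rpow_one]; linarith
    have h3 : 0 ≤ (η + 0) ^ ((1/4) : ℝ) := by positivity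
    linarith

lemma cont_34 {η : ℝ} (hη : 0 < η) : Continuous (fun u : ℝ => (η + |u|) ^ (-(3/4) : ℝ)) := by
  apply Continuous.rpow_const (by fun_prop)
  intro x; left; positivity

lemma lint_34_abs {η : ℝ} (hη : 0 < η) (hη1 : η ≤ 1/2) (y : ℝ) (h0 : 0 ≤ y) (h1 : y ≤ 1/2) :
    (∫⁻ x in Set.Icc (-(1/2) : ℝ) (1/2), ENNReal.ofReal ((η + |(|x| - y)|) ^ (-(3/4) : ℝ))) ≤
      ENNReal.ofReal 48 := by
  have := lint_abs (fun u => (η + u) ^ (-(3/4) : ℝ)) 24 (by positivity)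
    (cont_34 hη) (fun z hz => lint_34 hη hη1 z hz) y h0 h1
  convert this using 2; norm_num

lemma vol_T3 : (volume : Measure (Fin 3 → ℝ)).restrict T3 =
    Measure.pi (fun _ : Fin 3 => volume.restrict (Set.Icc (-(1/2) : ℝ) (1/2))) := by
  rw [T3, volume_pi, Measure.restrict_pi_pi]

lemma lint_T3 (f : (Fin 3 → ℝ) → ENNReal) (hf : Measurable f) :
    ∫⁻ p in T3, f p = ∫⁻ x in Set.Icc (-(1/2) : ℝ) (1/2), ∫⁻ y in Set.Icc (-(1/2) : ℝ) (1/2),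
      ∫⁻ z in Set.Icc (-(1/2) : ℝ) (1/2), f ![x, y, z] := by
  rw [vol_T3]
  set μ : Measure ℝ := volume.restrict (Set.Icc (-(1/2) : ℝ) (1/2))
  have h3 := (measurePreserving_piFinSuccAbove (fun _ : Fin 3 => μ) 0).symm
  rw [← h3.lintegral_comp hf, lintegral_prod _ (by
    exact (hf.comp (MeasurableEquiv.measurable _)).aemeasurable)]
  apply lintegral_congr; intro x
  have h2 := (measurePreserving_piFinSuccAbove (fun _ : Fin 2 => μ) 0).symm
  have hm : Measurable fun q : Fin 2 → ℝ => f ((MeasurableEquiv.piFinSuccAbove (fun _ : Fin 3 => ℝ) 0).symm (x, q)) :=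
    hf.comp ((MeasurableEquiv.measurable _).comp measurable_prodMk_left)
  refine (h2.lintegral_comp hm).symm.trans ?_
  rw [lintegral_prod _ (by
    exact (hm.comp (MeasurableEquiv.measurable _)).aemeasurable)]
  apply lintegral_congr; intro y
  have h1 := (measurePreserving_funUnique μ (Fin 1)).symm
  have hm1 : Measurable fun q : Fin 1 → ℝ => f ((MeasurableEquiv.piFinSuccAbove (fun _ : Fin 3 => ℝ) 0).symm (x, (MeasurableEquiv.piFinSuccAbove (fun _ : Fin 2 => ℝ) 0).symm (y, q))) :=
    hm.comp ((MeasurableEquiv.measurable _).comp measurable_prodMk_left)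
  refine (h1.lintegral_comp hm1).symm.trans ?_
  apply lintegral_congr; intro z
  congr 1
  ext i; fin_cases i <;> rfl

lemma int_T3 (f : (Fin 3 → ℝ) → ℂ) (hf : Continuous f) :
    ∫ p in T3, f p = ∫ x in Set.Icc (-(1/2) : ℝ) (1/2), ∫ y in Set.Icc (-(1/2) : ℝ) (1/2),
      ∫ z in Set.Icc (-(1/2) : ℝ) (1/2), f ![x, y, z] := by
  have hIf : IntegrableOn f T3 := by
    apply hf.continuousOn.integrableOn_compact
    exact isCompact_univ_pi (fun _ => isCompact_Icc)
  unfold IntegrableOn at hIf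
  rw [vol_T3] at hIf ⊢
  set μ : Measure ℝ := volume.restrict (Set.Icc (-(1/2) : ℝ) (1/2))
  have hc1 : Continuous fun q : ℝ × (Fin 2 → ℝ) => f ((MeasurableEquiv.piFinSuccAbove (fun _ : Fin 3 => ℝ) 0).symm q) := by
    apply hf.comp
    refine continuous_pi fun i => ?_
    fin_cases i
    · exact continuous_fst
    · exact (continuous_apply 0).comp continuous_snd
    · exact (continuous_apply 1).comp continuous_snd
  have h3 := (measurePreserving_piFinSuccAbove (fun _ : Fin 3 => μ) 0).symm
  rw [← h3.integral_comp' f, integral_prod _ (by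
    exact (h3.integrable_comp_emb (MeasurableEquiv.measurableEmbedding _)).2 hIf)]
  congr 1; ext x
  have h2 := (measurePreserving_piFinSuccAbove (fun _ : Fin 2 => μ) 0).symm
  have hx : Continuous fun q : Fin 2 → ℝ => f ((MeasurableEquiv.piFinSuccAbove (fun _ : Fin 3 => ℝ) 0).symm (x, q)) :=
    hc1.comp (Continuous.prodMk_right x)
  have hIf2 : Integrable (fun q : Fin 2 → ℝ => f ((MeasurableEquiv.piFinSuccAbove (fun _ : Fin 3 => ℝ) 0).symm (x, q))) (Measure.pi (fun _ : Fin 2 => μ)) := by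
    have : IntegrableOn (fun q : Fin 2 → ℝ => f ((MeasurableEquiv.piFinSuccAbove (fun _ : Fin 3 => ℝ) 0).symm (x, q))) (Set.univ.pi (fun _ => Set.Icc (-(1/2) : ℝ) (1/2))) := by
      apply hx.continuousOn.integrableOn_compact
      exact isCompact_univ_pi (fun _ => isCompact_Icc)
    unfold IntegrableOn at this
    rwa [volume_pi, Measure.restrict_pi_pi] at this
  refine (h2.integral_comp' _).symm.trans ?_
  rw [integral_prod _ (by
    exact (h2.integrable_comp_emb (MeasurableEquiv.measurableEmbedding _)).2 hIf2)]
  congr 1; ext y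
  have h1 := (measurePreserving_funUnique μ (Fin 1)).symm
  refine (h1.integral_comp' (fun q => f ((MeasurableEquiv.piFinSuccAbove (fun _ : Fin 3 => ℝ) 0).symm (x, (MeasurableEquiv.piFinSuccAbove (fun _ : Fin 2 => ℝ) 0).symm (y, q))))).symm.trans ?_
  congr 1; ext z
  congr 1
  ext i; fin_cases i <;> rfl

lemma exists_joukowski (w : ℂ) (hw : w.im ≠ 0) : ∃ v : ℂ, v ≠ 0 ∧ ‖v‖ < 1 ∧ w = (v + v⁻¹) / 2 := by
  obtain ⟨s, hs⟩ := IsAlgClosed.exists_pow_nat_eq (w ^ 2 - 1) (n := 2) (by norm_num)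
  have hprod : (w + s) * (w - s) = 1 := by linear_combination -hs
  have h0 : w + s ≠ 0 := left_ne_zero_of_mul_eq_one hprod
  have hinv : (w + s)⁻¹ = w - s := inv_eq_of_mul_eq_one_right hprod
  have hinv' : (w - s)⁻¹ = w + s := inv_eq_of_mul_eq_one_left hprod
  have hne : ‖w + s‖ ≠ 1 := by
    intro h
    have h2 : (w + s)⁻¹ = (starRingEnd ℂ) (w + s) := by
      rw [Complex.inv_def, Complex.normSq_eq_norm_sq, h]; simp
    rw [hinv] at h2
    have e1 := congrArg Complex.im h2
    simp at e1
    exact hw (by linarith)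
  rcases lt_or_gt_of_ne hne with h | h
  · exact ⟨w + s, h0, h, by rw [hinv]; ring⟩
  · refine ⟨w - s, right_ne_zero_of_mul_eq_one hprod, ?_, by rw [hinv']; ring⟩
    rw [← hinv, norm_inv]
    exact inv_lt_one_of_one_lt₀ h

lemma cint_formula (w : ℂ) (hw : w.im ≠ 0) :
    ‖∫ x in Set.Icc (-(1/2) : ℝ) (1/2), (w + (Real.cos (2 * Real.pi * x) : ℂ))⁻¹‖ ^ 2 * ‖w ^ 2 - 1‖ = 1 := by
  obtain ⟨v, hv0, hv1, hv⟩ := exists_joukowski w hw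
  have hvn : 1 < ‖v⁻¹‖ := by
    rw [norm_inv]; exact (one_lt_inv₀ (norm_pos_iff.2 hv0)).2 hv1
  have hne : ∀ z ∈ Metric.closedBall (0:ℂ) 1, z + v⁻¹ ≠ 0 := by
    intro z hz h
    have : z = -v⁻¹ := eq_neg_of_add_eq_zero_left h
    rw [mem_closedBall_zero_iff, this, norm_neg] at hz
    linarith
  have hmv := circleAverage_sub_sub_inv_smul_of_differentiable_on_off_countable (c := 0) (R := 1)
    (w := -v) (f := fun z : ℂ => 2 / (z + v⁻¹)) (s := ∅) Set.countable_empty (by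
      rw [abs_one]
      exact ContinuousOn.div (by fun_prop) (by fun_prop) hne) (by
      rw [abs_one]
      intro z hz
      have := hne z (Metric.ball_subset_closedBall hz.1)
      exact DifferentiableAt.div (by fun_prop) (by fun_prop) this) (by simpa using hv1)
  have hI : ∫ x in Set.Icc (-(1/2) : ℝ) (1/2), (w + (Real.cos (2 * Real.pi * x) : ℂ))⁻¹ = 2 / (-v + v⁻¹) := by
    rw [← hmv, Real.circleAverage_eq_integral_add (-Real.pi),
      intervalIntegral.integral_comp_add_right (fun θ => ((circleMap 0 1 θ - 0) / (circleMap 0 1 θ - -v)) • (2 / (circleMap 0 1 θ + v⁻¹))),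
      integral_Icc_eq_integral_Ioc, ← intervalIntegral.integral_of_le (by norm_num),
      intervalIntegral.integral_comp_mul_left (fun θ => (w + (Real.cos θ : ℂ))⁻¹) (by positivity)]
    congr 1
    rw [show 2 * Real.pi * (-(1/2)) = 0 + -Real.pi by ring, show 2 * Real.pi * (1/2) = 2 * Real.pi + -Real.pi by ring]
    apply intervalIntegral.integral_congr
    intro θ _
    simp only [circleMap, zero_add, Complex.ofReal_one, one_mul, sub_zero, sub_neg_eq_add, smul_eq_mul]
    set ζ := Complex.exp (θ * Complex.I) with hζ
    have hζ0 : ζ ≠ 0 := Complex.exp_ne_zero _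
    have hcos : (Real.cos θ : ℂ) = (ζ + ζ⁻¹) / 2 := by
      rw [Complex.ofReal_cos, Complex.cos, hζ, ← Complex.exp_neg, neg_mul]
    have : w + (Real.cos θ : ℂ) = (ζ + v) * (ζ + v⁻¹) / (2 * ζ) := by
      rw [hcos, hv]; field_simp; ring
    rw [this, inv_div, mul_comm 2 ζ, mul_div_mul_comm]
  rw [hI, ← norm_pow, ← norm_mul, hv]
  have hd : -v + v⁻¹ ≠ 0 := by
    intro h
    have h2 : v⁻¹ = v := by linear_combination h
    rw [h2] at hvn; linarith
  have hd2 : 1 - v ^ 2 ≠ 0 := by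
    intro h; apply hd; field_simp; linear_combination h
  have : (2 / (-v + v⁻¹)) ^ 2 * (((v + v⁻¹) / 2) ^ 2 - 1) = 1 := by
    have e : ((v + v⁻¹) / 2) ^ 2 - 1 = (-v + v⁻¹) ^ 2 / 4 := by
      field_simp; ring
    rw [e, div_pow, div_mul_div_comm, div_eq_one_iff_eq (mul_ne_zero (pow_ne_zero 2 hd) (by norm_num))]; ring
  rw [this, norm_one]

lemma cint_bound (w : ℂ) (a ε : ℝ) (hε : 0 < ε) (ha : w.re = a) (hw : w.im = ε) :
    ‖∫ x in Set.Icc (-(1/2) : ℝ) (1/2), (w + (Real.cos (2 * Real.pi * x) : ℂ))⁻¹‖ ≤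
      2 * ((|a - 1| + ε) ^ (-(1/2) : ℝ) + (|a + 1| + ε) ^ (-(1/2) : ℝ)) := by
  have hf := cint_formula w (by rw [hw]; exact hε.ne')
  set J := ‖∫ x in Set.Icc (-(1/2) : ℝ) (1/2), (w + (Real.cos (2 * Real.pi * x) : ℂ))⁻¹‖
  have hJ : 0 ≤ J := norm_nonneg _
  have hP : ‖w ^ 2 - 1‖ = ‖w - 1‖ * ‖w + 1‖ := by rw [← norm_mul]; congr 1; ring
  have m1 : |a - 1| ≤ ‖w - 1‖ := by
    have := Complex.abs_re_le_norm (w - 1); simpa [ha] using this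
  have m2 : |a + 1| ≤ ‖w + 1‖ := by
    have := Complex.abs_re_le_norm (w + 1); simpa [ha] using this
  have m3 : ε ≤ ‖w - 1‖ := by
    have := Complex.abs_im_le_norm (w - 1); simp [hw] at this; exact (le_abs_self _).trans this
  have m4 : ε ≤ ‖w + 1‖ := by
    have := Complex.abs_im_le_norm (w + 1); simp [hw] at this; exact (le_abs_self _).trans this
  have conc : ∀ N : ℝ, 0 < N → N / 2 ≤ ‖w ^ 2 - 1‖ → J ≤ 2 * N ^ (-(1/2) : ℝ) := by
    intro N hN hNP
    have hsq : (N ^ (-(1/2) : ℝ)) ^ 2 = N⁻¹ := by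
      rw [← Real.rpow_natCast, ← Real.rpow_mul hN.le]; norm_num [Real.rpow_neg_one]
    apply abs_le_of_sq_le_sq' _ (by positivity) |>.2
    rw [mul_pow, hsq]
    have h1 : J ^ 2 * (N / 2) ≤ 1 := hf ▸ mul_le_mul_of_nonneg_left hNP (sq_nonneg J)
    have : J ^ 2 ≤ 2 * N⁻¹ := by
      rw [← div_eq_mul_inv, le_div_iff₀ hN]; linarith
    have := inv_pos.2 hN
    linarith
  have p1 : 0 ≤ (|a - 1| + ε) ^ (-(1/2) : ℝ) := by positivity
  have p2 : 0 ≤ (|a + 1| + ε) ^ (-(1/2) : ℝ) := by positivity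
  rcases le_total 0 a with h | h
  · have hb : 1 ≤ ‖w + 1‖ := by
      have := le_abs_self (a + 1); linarith
    have := conc (|a - 1| + ε) (by positivity) (by rw [hP]; nlinarith)
    linarith
  · have hb : 1 ≤ ‖w - 1‖ := by
      have := neg_le_abs (a - 1); linarith
    have := conc (|a + 1| + ε) (by positivity) (by rw [hP]; nlinarith)
    linarith

lemma mid_theta {ε : ℝ} (hη : 0 < ε) (hη1 : ε ≤ 1/2) (s : ℝ) :
    (∫⁻ x in Set.Icc (-(1/2) : ℝ) (1/2), ENNReal.ofReal ((|s - Real.cos (2 * Real.pi * x)| + ε) ^ (-(1/2) : ℝ))) ≤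
      ENNReal.ofReal (144 * (Real.sqrt |(1 - |s|)| + Real.sqrt ε) ^ (-(1/4) : ℝ)) := by
  obtain ⟨y, h0, h1, hy⟩ := key2 s
  set P := Real.sqrt |(1 - |s|)| + Real.sqrt ε
  have hP : 0 < P := by have := Real.sqrt_pos.2 hη; positivity
  calc _ ≤ ∫⁻ x in Set.Icc (-(1/2) : ℝ) (1/2),
        ENNReal.ofReal (3 * P ^ (-(1/4) : ℝ)) * ENNReal.ofReal ((ε + |(|x| - y)|) ^ (-(3/4) : ℝ)) := by
        apply setLIntegral_mono' measurableSet_Icc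
        intro x hx
        rw [← ENNReal.ofReal_mul (by positivity)]
        apply ENNReal.ofReal_le_ofReal
        obtain ⟨k1, k2⟩ := hy x hx ε hη hη1
        set N := |s - Real.cos (2 * Real.pi * x)| + ε
        have hN : 0 < N := by positivity
        set Q := ε + |(|x| - y)|
        have hQ : 0 < Q := by positivity
        have e1 : N ^ (-(1/2) : ℝ) = (N ^ 2) ^ (-(1/4) : ℝ) := by
          rw [← Real.rpow_natCast, ← Real.rpow_mul hN.le]; norm_num
        have e2 : Q ^ (-(3/4) : ℝ) = (Q ^ 3) ^ (-(1/4) : ℝ) := by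
          rw [← Real.rpow_natCast, ← Real.rpow_mul hQ.le]; norm_num
        have e3 : (3⁻¹ : ℝ) ^ (-(1/4) : ℝ) ≤ 3 := by
          rw [Real.inv_rpow (by norm_num), ← Real.rpow_neg (by norm_num), neg_neg]
          calc (3:ℝ) ^ (1/4 : ℝ) ≤ 3 ^ (1 : ℝ) := Real.rpow_le_rpow_of_exponent_le (by norm_num) (by norm_num)
            _ = 3 := Real.rpow_one 3
        have hmul : 3⁻¹ * P * Q ^ 3 ≤ N ^ 2 := by
          have : P * Q * Q ^ 2 ≤ 3 * N * N := by gcongr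
          nlinarith
        calc N ^ (-(1/2) : ℝ) = (N ^ 2) ^ (-(1/4) : ℝ) := e1
          _ ≤ (3⁻¹ * P * Q ^ 3) ^ (-(1/4) : ℝ) :=
            Real.rpow_le_rpow_of_nonpos (by positivity) hmul (by norm_num)
          _ = 3⁻¹ ^ (-(1/4) : ℝ) * P ^ (-(1/4) : ℝ) * (Q ^ 3) ^ (-(1/4) : ℝ) := by
            rw [Real.mul_rpow (by positivity) (by positivity), Real.mul_rpow (by positivity) (by positivity)]
          _ ≤ 3 * P ^ (-(1/4) : ℝ) * Q ^ (-(3/4) : ℝ) := by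
            rw [e2]; gcongr
    _ = ENNReal.ofReal (3 * P ^ (-(1/4) : ℝ)) * ∫⁻ x in Set.Icc (-(1/2) : ℝ) (1/2),
          ENNReal.ofReal ((ε + |(|x| - y)|) ^ (-(3/4) : ℝ)) := by
        rw [lintegral_const_mul' _ _ ENNReal.ofReal_ne_top]
    _ ≤ ENNReal.ofReal (3 * P ^ (-(1/4) : ℝ)) * ENNReal.ofReal 48 := by
        gcongr; exact lint_34_abs hη hη1 y h0 h1
    _ = _ := by rw [← ENNReal.ofReal_mul (by positivity)]; congr 1; ring

lemma outer_theta {ε : ℝ} (hη : 0 < ε) (hη1 : ε ≤ 1/2) (u : ℝ) :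
    (∫⁻ x in Set.Icc (-(1/2) : ℝ) (1/2), ENNReal.ofReal (144 * (Real.sqrt |(1 - |u - Real.cos (2 * Real.pi * x)|)| + Real.sqrt ε) ^ (-(1/4) : ℝ))) ≤
      ENNReal.ofReal (144 * 96) := by
  obtain ⟨y, y', ⟨h0, h1⟩, ⟨h0', h1'⟩, hy⟩ := key3 u
  have hm : ∀ y : ℝ, Measurable fun x : ℝ => ENNReal.ofReal ((ε + |(|x| - y)|) ^ (-(3/4) : ℝ)) := by
    intro y
    exact ((cont_34 hη).comp (continuous_abs.sub continuous_const)).measurable.ennreal_ofReal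
  calc _ ≤ ∫⁻ x in Set.Icc (-(1/2) : ℝ) (1/2), ENNReal.ofReal 144 *
        (ENNReal.ofReal ((ε + |(|x| - y)|) ^ (-(3/4) : ℝ)) + ENNReal.ofReal ((ε + |(|x| - y')|) ^ (-(3/4) : ℝ))) := by
        apply setLIntegral_mono' measurableSet_Icc
        intro x hx
        rw [ENNReal.ofReal_mul (by norm_num)]
        gcongr
        have aux : ∀ y : ℝ, 0 ≤ y → y ≤ 1/2 → ε + |(|x| - y)| ≤ Real.sqrt |(1 - |u - Real.cos (2 * Real.pi * x)|)| + Real.sqrt ε →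
            ENNReal.ofReal ((Real.sqrt |(1 - |u - Real.cos (2 * Real.pi * x)|)| + Real.sqrt ε) ^ (-(1/4) : ℝ)) ≤ ENNReal.ofReal ((ε + |(|x| - y)|) ^ (-(3/4) : ℝ)) := by
          intro y hy0 hy1 h
          apply ENNReal.ofReal_le_ofReal
          have hxa : |x| ≤ 1/2 := abs_le.2 ⟨by linarith [hx.1], hx.2⟩
          have : |(|x| - y)| ≤ 1/2 := abs_le.2 ⟨by linarith [abs_nonneg x], by linarith⟩
          refine (Real.rpow_le_rpow_of_nonpos (by positivity) h (by norm_num)).trans ?_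
          exact Real.rpow_le_rpow_of_exponent_ge (by positivity) (by linarith) (by norm_num)
        rcases hy x hx ε hη hη1 with h | h
        · exact (aux y h0 h1 h).trans le_self_add
        · exact (aux y' h0' h1' h).trans le_add_self
    _ = ENNReal.ofReal 144 * ((∫⁻ x in Set.Icc (-(1/2) : ℝ) (1/2), ENNReal.ofReal ((ε + |(|x| - y)|) ^ (-(3/4) : ℝ))) + ∫⁻ x in Set.Icc (-(1/2) : ℝ) (1/2), ENNReal.ofReal ((ε + |(|x| - y')|) ^ (-(3/4) : ℝ))) := by
        rw [lintegral_const_mul' _ _ ENNReal.ofReal_ne_top, lintegral_add_left (hm y)]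
    _ ≤ ENNReal.ofReal 144 * (ENNReal.ofReal 48 + ENNReal.ofReal 48) := by
        gcongr
        · exact lint_34_abs hη hη1 y h0 h1
        · exact lint_34_abs hη hη1 y' h0' h1'
    _ = _ := by
        rw [← ENNReal.ofReal_add (by norm_num) (by norm_num), ← ENNReal.ofReal_mul (by norm_num)]; norm_num

lemma continuous_edisp : Continuous edisp := by
  unfold edisp
  fun_prop

lemma edisp_vec (x y z : ℝ) : edisp ![x, y, z] =
    3 - Real.cos (2 * Real.pi * x) - Real.cos (2 * Real.pi * y) - Real.cos (2 * Real.pi * z) := by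
  simp [edisp, Fin.sum_univ_three]; ring

lemma thetaEps_bound {ε : ℝ} (hη : 0 < ε) (hη1 : ε ≤ 1/2) (α : ℝ) :
    ‖ThetaEps ε α‖ ≤ 4 * (144 * 96) := by
  have hcont : Continuous fun q : Fin 3 → ℝ => ((α : ℂ) - (edisp q : ℂ) + (ε : ℂ) * Complex.I)⁻¹ := by
    have := continuous_edisp
    apply Continuous.inv₀ (by fun_prop)
    intro q h
    have := congrArg Complex.im h
    simp at this
    exact hη.ne' this
  have hm : ∀ s : ℝ, Measurable fun y : ℝ => ENNReal.ofReal ((|s - Real.cos (2 * Real.pi * y)| + ε) ^ (-(1/2) : ℝ)) := by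
    intro s
    fun_prop
  have hm2 : ∀ u : ℝ, Measurable fun x : ℝ => ENNReal.ofReal (144 * (Real.sqrt |(1 - |u - Real.cos (2 * Real.pi * x)|)| + Real.sqrt ε) ^ (-(1/4) : ℝ)) := by
    intro s
    fun_prop
  have key : ‖ThetaEps ε α‖ₑ ≤ ENNReal.ofReal (4 * (144 * 96)) := by
    unfold ThetaEps
    rw [int_T3 _ hcont]
    calc _ ≤ ∫⁻ x in Set.Icc (-(1/2) : ℝ) (1/2), ‖_‖ₑ := enorm_integral_le_lintegral_enorm _
      _ ≤ ∫⁻ x in Set.Icc (-(1/2) : ℝ) (1/2), ∫⁻ y in Set.Icc (-(1/2) : ℝ) (1/2), ‖_‖ₑ := by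
        apply lintegral_mono; intro x
        exact enorm_integral_le_lintegral_enorm _
      _ ≤ ∫⁻ x in Set.Icc (-(1/2) : ℝ) (1/2), ∫⁻ y in Set.Icc (-(1/2) : ℝ) (1/2),
          (ENNReal.ofReal 2 * (ENNReal.ofReal ((|((4 - α) - Real.cos (2 * Real.pi * x)) - Real.cos (2 * Real.pi * y)| + ε) ^ (-(1/2) : ℝ)) +
          ENNReal.ofReal ((|((2 - α) - Real.cos (2 * Real.pi * x)) - Real.cos (2 * Real.pi * y)| + ε) ^ (-(1/2) : ℝ)))) := by
        apply lintegral_mono; intro x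
        apply lintegral_mono; intro y
        have hb := cint_bound (((α - 3 + Real.cos (2 * Real.pi * x) + Real.cos (2 * Real.pi * y) : ℝ) : ℂ) + (ε : ℂ) * Complex.I)
          (α - 3 + Real.cos (2 * Real.pi * x) + Real.cos (2 * Real.pi * y)) ε hη (by simp [-Complex.ofReal_cos]) (by simp [-Complex.ofReal_cos])
        beta_reduce
        rw [← ENNReal.ofReal_add (by positivity) (by positivity), ← ENNReal.ofReal_mul (by norm_num), ← ofReal_norm]
        apply ENNReal.ofReal_le_ofReal
        have e1 : |4 - α - Real.cos (2 * Real.pi * x) - Real.cos (2 * Real.pi * y)| = |α - 3 + Real.cos (2 * Real.pi * x) + Real.cos (2 * Real.pi * y) - 1| := by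
          rw [← abs_neg]; congr 1; ring
        have e2 : |2 - α - Real.cos (2 * Real.pi * x) - Real.cos (2 * Real.pi * y)| = |α - 3 + Real.cos (2 * Real.pi * x) + Real.cos (2 * Real.pi * y) + 1| := by
          rw [← abs_neg]; congr 1; ring
        rw [e1, e2]
        refine le_trans (le_of_eq ?_) hb
        congr 2
        ext z
        rw [edisp_vec]; push_cast; congr 1; ring
      _ = ENNReal.ofReal 2 * ∫⁻ x in Set.Icc (-(1/2) : ℝ) (1/2), ((∫⁻ y in Set.Icc (-(1/2) : ℝ) (1/2),
          ENNReal.ofReal ((|((4 - α) - Real.cos (2 * Real.pi * x)) - Real.cos (2 * Real.pi * y)| + ε) ^ (-(1/2) : ℝ))) +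
          ∫⁻ y in Set.Icc (-(1/2) : ℝ) (1/2), ENNReal.ofReal ((|((2 - α) - Real.cos (2 * Real.pi * x)) - Real.cos (2 * Real.pi * y)| + ε) ^ (-(1/2) : ℝ))) := by
        rw [← lintegral_const_mul' _ _ ENNReal.ofReal_ne_top]
        apply lintegral_congr; intro x
        rw [lintegral_const_mul' _ _ ENNReal.ofReal_ne_top, lintegral_add_left (hm _)]
      _ ≤ ENNReal.ofReal 2 * ∫⁻ x in Set.Icc (-(1/2) : ℝ) (1/2),
          (ENNReal.ofReal (144 * (Real.sqrt |(1 - |(4 - α) - Real.cos (2 * Real.pi * x)|)| + Real.sqrt ε) ^ (-(1/4) : ℝ)) +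
          ENNReal.ofReal (144 * (Real.sqrt |(1 - |(2 - α) - Real.cos (2 * Real.pi * x)|)| + Real.sqrt ε) ^ (-(1/4) : ℝ))) := by
        gcongr with x
        · exact mid_theta hη hη1 _
        · exact mid_theta hη hη1 _
      _ ≤ ENNReal.ofReal 2 * (ENNReal.ofReal (144 * 96) + ENNReal.ofReal (144 * 96)) := by
        rw [lintegral_add_left (hm2 _)]
        gcongr
        · exact outer_theta hη hη1 _
        · exact outer_theta hη hη1 _
      _ = _ := by
        rw [← ENNReal.ofReal_add (by norm_num) (by norm_num), ← ENNReal.ofReal_mul (by norm_num)]; norm_num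
  rw [← ofReal_norm] at key
  exact (ENNReal.ofReal_le_ofReal_iff (by norm_num)).1 key

lemma thetaEps_im {ε : ℝ} (hη : 0 < ε) (α : ℝ) : (ThetaEps ε α).im ≤ 0 := by
  unfold ThetaEps
  by_cases hi : Integrable (fun q : Fin 3 → ℝ => ((α : ℂ) - (edisp q : ℂ) + (ε : ℂ) * Complex.I)⁻¹) (volume.restrict T3)
  · have := integral_im hi
    simp only [RCLike.im_to_complex] at this
    rw [← this]
    apply integral_nonpos
    intro q
    simp only [Complex.inv_im, Pi.zero_apply]
    apply div_nonpos_of_nonpos_of_nonneg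
    · simp; exact hη.le
    · exact Complex.normSq_nonneg _
  · rw [integral_undef hi]; simp

lemma theta_bound {Θ : ℝ → ℂ} (h : IsThetaLimit Θ) (α : ℝ) :
    ‖Θ α‖ ≤ 4 * (144 * 96) ∧ (Θ α).im ≤ 0 := by
  have hev : ∀ᶠ ε in 𝓝[>] (0:ℝ), 0 < ε ∧ ε ≤ 1/2 := by
    have := Ioc_mem_nhdsGT (show (0:ℝ) < 1/2 by norm_num)
    exact this
  constructor
  · exact le_of_tendsto (h α).norm (hev.mono fun ε hε => thetaEps_bound hε.1 hε.2 α)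
  · exact le_of_tendsto ((Complex.continuous_im.tendsto _).comp (h α)) (hev.mono fun ε hε => thetaEps_im hε.1 α)

lemma inner_one {η : ℝ} (hη : 0 < η) (hη1 : η ≤ 1/2) (a : ℝ) :
    (∫⁻ x in Set.Icc (-(1/2) : ℝ) (1/2), ENNReal.ofReal ((|a - Real.cos (2 * Real.pi * x)| + η)⁻¹)) ≤
      ENNReal.ofReal (36 * |Real.log η|) * ENNReal.ofReal ((Real.sqrt |(1 - |a|)| + Real.sqrt η)⁻¹) := by
  obtain ⟨y, h0, h1, hy⟩ := key2 a
  set P := Real.sqrt |(1 - |a|)| + Real.sqrt η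
  have hP : 0 < P := by have := Real.sqrt_pos.2 hη; positivity
  calc _ ≤ ∫⁻ x in Set.Icc (-(1/2) : ℝ) (1/2),
        ENNReal.ofReal (3 * P⁻¹) * ENNReal.ofReal ((η + |(|x| - y)|)⁻¹) := by
        apply setLIntegral_mono' measurableSet_Icc
        intro x hx
        rw [← ENNReal.ofReal_mul (by positivity)]
        apply ENNReal.ofReal_le_ofReal
        obtain ⟨k1, -⟩ := hy x hx η hη hη1
        rw [mul_assoc 3, ← mul_inv, ← div_eq_mul_inv, inv_le_comm₀ (by positivity) (by positivity), inv_div]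
        linarith
    _ = ENNReal.ofReal (3 * P⁻¹) * ∫⁻ x in Set.Icc (-(1/2) : ℝ) (1/2),
          ENNReal.ofReal ((η + |(|x| - y)|)⁻¹) := by
        rw [lintegral_const_mul' _ _ ENNReal.ofReal_ne_top]
    _ ≤ ENNReal.ofReal (3 * P⁻¹) * ENNReal.ofReal (12 * |Real.log η|) := by
        gcongr; exact lint_one_abs hη hη1 y h0 h1
    _ = _ := by rw [← ENNReal.ofReal_mul (by positivity), ← ENNReal.ofReal_mul (by positivity)]; congr 1; ring

lemma mid_one {η : ℝ} (hη : 0 < η) (hη1 : η ≤ 1/2) (u : ℝ) :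
    (∫⁻ x in Set.Icc (-(1/2) : ℝ) (1/2), ENNReal.ofReal ((Real.sqrt |(1 - |u - Real.cos (2 * Real.pi * x)|)| + Real.sqrt η)⁻¹)) ≤
      ENNReal.ofReal (24 * |Real.log η|) := by
  obtain ⟨y, y', ⟨h0, h1⟩, ⟨h0', h1'⟩, hy⟩ := key3 u
  have hm : ∀ y : ℝ, Measurable fun x : ℝ => ENNReal.ofReal ((η + |(|x| - y)|)⁻¹) := by
    intro y
    exact ((cont_one hη).comp (continuous_abs.sub continuous_const)).measurable.ennreal_ofReal
  calc _ ≤ ∫⁻ x in Set.Icc (-(1/2) : ℝ) (1/2),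
        (ENNReal.ofReal ((η + |(|x| - y)|)⁻¹) + ENNReal.ofReal ((η + |(|x| - y')|)⁻¹)) := by
        apply setLIntegral_mono' measurableSet_Icc
        intro x hx
        rcases hy x hx η hη hη1 with h | h
        · exact (ENNReal.ofReal_le_ofReal (inv_anti₀ (by positivity) h)).trans le_self_add
        · exact (ENNReal.ofReal_le_ofReal (inv_anti₀ (by positivity) h)).trans le_add_self
    _ = _ := lintegral_add_left (hm y) _
    _ ≤ ENNReal.ofReal (12 * |Real.log η|) + ENNReal.ofReal (12 * |Real.log η|) := by
        gcongr
        · exact lint_one_abs hη hη1 y h0 h1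
        · exact lint_one_abs hη hη1 y' h0' h1'
    _ = _ := by rw [← ENNReal.ofReal_add (by positivity) (by positivity)]; congr 1; ring

/-- four-point majorant of the inverse distance to the half-integer lattice -/
def fourK (η t x : ℝ) : ℝ :=
  (η + |x - (t - 1)|)⁻¹ + (η + |x - (t - 1/2)|)⁻¹ + (η + |x - t|)⁻¹ + (η + |x - (t + 1/2)|)⁻¹

lemma fourK_cont {η : ℝ} (hη : 0 < η) (t : ℝ) : Continuous (fourK η t) := by
  have h : ∀ z : ℝ, Continuous fun x : ℝ => (η + |x - z|)⁻¹ := fun z =>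
    (cont_one hη).comp (continuous_id.sub continuous_const)
  unfold fourK
  exact (((h _).add (h _)).add (h _)).add (h _)

lemma fourK_nonneg {η : ℝ} (hη : 0 < η) (t x : ℝ) : 0 ≤ fourK η t x := by
  unfold fourK; positivity

lemma lint_fourK {η : ℝ} (hη : 0 < η) (hη1 : η ≤ 1/2) (t : ℝ) (h0 : 0 ≤ t) (h1 : t ≤ 1/2) :
    (∫⁻ x in Set.Icc (-(1/2) : ℝ) (1/2), ENNReal.ofReal (fourK η t x)) ≤
      ENNReal.ofReal (24 * |Real.log η|) := by
  have hm : ∀ z : ℝ, Measurable fun x : ℝ => ENNReal.ofReal ((η + |x - z|)⁻¹) := fun z =>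
    ((cont_one hη).comp (continuous_id.sub continuous_const)).measurable.ennreal_ofReal
  have e : ∀ x, ENNReal.ofReal (fourK η t x) = ENNReal.ofReal ((η + |x - (t - 1)|)⁻¹) +
      ENNReal.ofReal ((η + |x - (t - 1/2)|)⁻¹) + ENNReal.ofReal ((η + |x - t|)⁻¹) +
      ENNReal.ofReal ((η + |x - (t + 1/2)|)⁻¹) := by
    intro x
    unfold fourK
    rw [ENNReal.ofReal_add (by positivity) (by positivity), ENNReal.ofReal_add (by positivity) (by positivity),
      ENNReal.ofReal_add (by positivity) (by positivity)]
  simp_rw [e]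
  rw [lintegral_add_right _ (hm _), lintegral_add_right _ (hm _), lintegral_add_right _ (hm _)]
  have b : ∀ z : ℝ, |z| ≤ 1 → _ := fun z hz => lint_one hη hη1 z hz
  calc _ ≤ ENNReal.ofReal (6 * |Real.log η|) + ENNReal.ofReal (6 * |Real.log η|) +
        ENNReal.ofReal (6 * |Real.log η|) + ENNReal.ofReal (6 * |Real.log η|) := by
        gcongr
        · exact b _ (abs_le.2 ⟨by linarith, by linarith⟩)
        · exact b _ (abs_le.2 ⟨by linarith, by linarith⟩)
        · exact b _ (abs_le.2 ⟨by linarith, by linarith⟩)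
        · exact b _ (abs_le.2 ⟨by linarith, by linarith⟩)
    _ = _ := by
      rw [← ENNReal.ofReal_add (by positivity) (by positivity), ← ENNReal.ofReal_add (by positivity) (by positivity),
        ← ENNReal.ofReal_add (by positivity) (by positivity)]
      congr 1; ring

lemma half_lattice (η : ℝ) (hη : 0 < η) (t x : ℝ) (h0 : 0 ≤ t) (h1 : t ≤ 1/2)
    (hx : x ∈ Set.Icc (-(1/2) : ℝ) (1/2)) (k : ℤ) :
    (η + |x - t - k / 2|)⁻¹ ≤ fourK η t x := by
  have p1 : 0 ≤ (η + |x - (t - 1)|)⁻¹ := by positivity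
  have p2 : 0 ≤ (η + |x - (t - 1/2)|)⁻¹ := by positivity
  have p3 : 0 ≤ (η + |x - t|)⁻¹ := by positivity
  have p4 : 0 ≤ (η + |x - (t + 1/2)|)⁻¹ := by positivity
  have aux : ∀ z : ℝ, |x - z| ≤ |x - t - k / 2| → (η + |x - t - k / 2|)⁻¹ ≤ (η + |x - z|)⁻¹ := by
    intro z hz
    apply inv_anti₀ (by positivity); linarith
  unfold fourK
  obtain ⟨hx0, hx1⟩ := hx
  rcases le_or_gt k (-2) with h | h
  · have hk : (k:ℝ) ≤ -2 := by exact_mod_cast h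
    have := aux (t - 1) (by rw [abs_of_nonneg (by linarith), abs_of_nonneg (by linarith)]; linarith)
    linarith
  rcases le_or_gt 1 k with h' | h'
  · have hk : (1:ℝ) ≤ k := by exact_mod_cast h'
    have := aux (t + 1/2) (by rw [abs_of_nonpos (by linarith), abs_of_nonpos (by linarith)]; linarith)
    linarith
  have : k = -1 ∨ k = 0 := by omega
  rcases this with rfl | rfl
  · have := aux (t - 1/2) (le_of_eq (by congr 1; push_cast; ring))
    linarith
  · have := aux t (le_of_eq (by congr 1; push_cast; ring))
    linarith

lemma tnorm_fourK (r : Fin 3 → ℝ) : ∃ t : ℝ, 0 ≤ t ∧ t ≤ 1/2 ∧ ∀ η : ℝ, 0 < η → ∀ p ∈ T3,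
    (tnorm η (p - r))⁻¹ ≤ fourK η t (p 0) := by
  refine ⟨Int.fract (2 * r 0) / 2, by have := Int.fract_nonneg (2 * r 0); positivity,
    by have := Int.fract_lt_one (2 * r 0); linarith, fun η hη p hp => ?_⟩
  set t := Int.fract (2 * r 0) / 2 with ht
  have ht0 : 0 ≤ t := by have := Int.fract_nonneg (2 * r 0); positivity
  have ht1 : t ≤ 1/2 := by have := Int.fract_lt_one (2 * r 0); linarith
  have hr : r 0 = t + (⌊2 * r 0⌋ : ℝ) / 2 := by
    have := Int.floor_add_fract (2 * r 0); linarith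
  have hx : p 0 ∈ Set.Icc (-(1/2) : ℝ) (1/2) := hp 0 (Set.mem_univ _)
  have hmin : min (cdist ((p - r) 0) 0) (cdist ((p - r) 0) (1/2)) ≤
      Real.sqrt (∑ j, (min (cdist ((p - r) j) 0) (cdist ((p - r) j) (1/2))) ^ 2) := by
    apply Real.le_sqrt_of_sq_le
    exact Finset.single_le_sum (f := fun j => (min (cdist ((p - r) j) 0) (cdist ((p - r) j) (1/2))) ^ 2)
      (fun j _ => sq_nonneg _) (Finset.mem_univ 0)
  have hk : ∃ k : ℤ, min (cdist ((p - r) 0) 0) (cdist ((p - r) 0) (1/2)) = |p 0 - t - k / 2| := by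
    rcases min_choice (cdist ((p - r) 0) 0) (cdist ((p - r) 0) (1/2)) with h | h
    · refine ⟨⌊2 * r 0⌋ + 2 * round ((p - r) 0 - 0), ?_⟩
      rw [h, cdist]; congr 1; simp only [Pi.sub_apply]; push_cast; linarith
    · refine ⟨⌊2 * r 0⌋ + 1 + 2 * round ((p - r) 0 - 1/2), ?_⟩
      rw [h, cdist]; congr 1; simp only [Pi.sub_apply]; push_cast; linarith
  obtain ⟨k, hk⟩ := hk
  refine le_trans ?_ (half_lattice η hη t (p 0) ht0 ht1 hx k)
  rw [← hk]
  apply inv_anti₀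
  · rw [hk]; positivity
  · unfold tnorm; linarith

lemma final_bound {η : ℝ} (hη : 0 < η) (hη1 : η ≤ 1/2) (α : ℝ) (r : Fin 3 → ℝ)
    (f : (Fin 3 → ℝ) → ℝ) (M : ℝ) (hM : 0 ≤ M) (hf0 : ∀ p, 0 ≤ f p)
    (hf : ∀ p ∈ T3, f p ≤ M * ((|α - edisp p| + η)⁻¹ * (tnorm η (p - r))⁻¹)) :
    ∫ p in T3, f p ≤ M * (20736 * |Real.log η| ^ 3) := by
  obtain ⟨t, ht0, ht1, ht⟩ := tnorm_fourK r
  have hT : MeasurableSet T3 := MeasurableSet.univ_pi (fun _ => measurableSet_Icc)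
  have hL := abs_nonneg (Real.log η)
  have hmeas : Measurable fun p : Fin 3 → ℝ => ENNReal.ofReal (M * fourK η t (p 0)) * ENNReal.ofReal ((|α - edisp p| + η)⁻¹) := by
    have h1 : Continuous fun p : Fin 3 → ℝ => M * fourK η t (p 0) :=
      continuous_const.mul ((fourK_cont hη t).comp (continuous_apply 0))
    have h2 := continuous_edisp
    have h3 : Continuous fun p : Fin 3 → ℝ => (|α - edisp p| + η)⁻¹ := by
      apply Continuous.inv₀ (by fun_prop)
      intro p; positivity
    exact h1.measurable.ennreal_ofReal.mul h3.measurable.ennreal_ofReal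
  have key : ∫⁻ p in T3, ENNReal.ofReal ‖f p‖ ≤ ENNReal.ofReal (M * (20736 * |Real.log η| ^ 3)) := by
    calc _ ≤ ∫⁻ p in T3, ENNReal.ofReal (M * fourK η t (p 0)) * ENNReal.ofReal ((|α - edisp p| + η)⁻¹) := by
          apply setLIntegral_mono' hT
          intro p hp
          have hK := fourK_nonneg hη t (p 0)
          rw [← ENNReal.ofReal_mul (by positivity), Real.norm_of_nonneg (hf0 p)]
          apply ENNReal.ofReal_le_ofReal
          calc f p ≤ M * ((|α - edisp p| + η)⁻¹ * (tnorm η (p - r))⁻¹) := hf p hp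
            _ ≤ M * ((|α - edisp p| + η)⁻¹ * fourK η t (p 0)) := by
              have := ht η hη p hp
              gcongr
            _ = _ := by ring
      _ = ∫⁻ x in Set.Icc (-(1/2) : ℝ) (1/2), ∫⁻ y in Set.Icc (-(1/2) : ℝ) (1/2),
          ∫⁻ z in Set.Icc (-(1/2) : ℝ) (1/2), ENNReal.ofReal (M * fourK η t x) *
            ENNReal.ofReal ((|((3 - α - Real.cos (2 * Real.pi * x)) - Real.cos (2 * Real.pi * y)) - Real.cos (2 * Real.pi * z)| + η)⁻¹) := by
          rw [lint_T3 _ hmeas]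
          apply lintegral_congr; intro x
          apply lintegral_congr; intro y
          apply lintegral_congr; intro z
          rw [edisp_vec, ← abs_neg]
          congr 5
          ring
      _ ≤ ∫⁻ x in Set.Icc (-(1/2) : ℝ) (1/2), ∫⁻ y in Set.Icc (-(1/2) : ℝ) (1/2),
          ENNReal.ofReal (M * fourK η t x) * (ENNReal.ofReal (36 * |Real.log η|) *
            ENNReal.ofReal ((Real.sqrt |(1 - |(3 - α - Real.cos (2 * Real.pi * x)) - Real.cos (2 * Real.pi * y)|)| + Real.sqrt η)⁻¹)) := by
          apply lintegral_mono; intro x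
          apply lintegral_mono; intro y
          beta_reduce
          rw [lintegral_const_mul' _ _ ENNReal.ofReal_ne_top]
          gcongr
          exact inner_one hη hη1 _
      _ ≤ ∫⁻ x in Set.Icc (-(1/2) : ℝ) (1/2),
          ENNReal.ofReal (M * fourK η t x) * (ENNReal.ofReal (36 * |Real.log η|) *
            ENNReal.ofReal (24 * |Real.log η|)) := by
          apply lintegral_mono; intro x
          beta_reduce
          rw [lintegral_const_mul' _ _ ENNReal.ofReal_ne_top, lintegral_const_mul' _ _ ENNReal.ofReal_ne_top]
          gcongr
          exact mid_one hη hη1 _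
      _ = (ENNReal.ofReal M * ∫⁻ x in Set.Icc (-(1/2) : ℝ) (1/2), ENNReal.ofReal (fourK η t x)) *
          (ENNReal.ofReal (36 * |Real.log η|) * ENNReal.ofReal (24 * |Real.log η|)) := by
          rw [← ENNReal.ofReal_mul (by positivity), lintegral_mul_const' _ _ ENNReal.ofReal_ne_top,
            ← lintegral_const_mul' _ _ ENNReal.ofReal_ne_top]
          simp_rw [ENNReal.ofReal_mul hM]
      _ ≤ (ENNReal.ofReal M * ENNReal.ofReal (24 * |Real.log η|)) *
          (ENNReal.ofReal (36 * |Real.log η|) * ENNReal.ofReal (24 * |Real.log η|)) := by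
          gcongr
          exact lint_fourK hη hη1 t ht0 ht1
      _ = _ := by
          rw [← ENNReal.ofReal_mul (by positivity), ← ENNReal.ofReal_mul (by positivity), ← ENNReal.ofReal_mul (by positivity)]
          congr 1; ring
  calc ∫ p in T3, f p ≤ ‖∫ p in T3, f p‖ := Real.le_norm_self _
    _ ≤ (∫⁻ p in T3, ENNReal.ofReal ‖f p‖).toReal := norm_integral_le_lintegral_norm _
    _ ≤ _ := ENNReal.toReal_le_of_le_ofReal (by positivity) key

lemma tnorm_pos {η : ℝ} (hη : 0 < η) (q : Fin 3 → ℝ) : 0 < tnorm η q := by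
  unfold tnorm; have := Real.sqrt_nonneg (∑ j, (min (cdist (q j) 0) (cdist (q j) (1/2))) ^ 2); linarith

lemma ptwise {G X K T : ℝ} (hG : 0 < G) (hX : 0 < X) (hT : 0 < T) (h : X ≤ K * G) :
    1 / (G * T) ≤ K * (X⁻¹ * T⁻¹) := by
  rw [one_div, mul_inv, ← mul_assoc]
  gcongr
  rw [← div_eq_mul_inv, le_div_iff₀ hX, inv_mul_le_iff₀ hG]; linarith

lemma part_one {η : ℝ} (hη : 0 < η) (hη1 : η ≤ 1/2) (α : ℝ) (r : Fin 3 → ℝ) :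
    (∫ p in T3, 1 / (‖(α : ℂ) - (edisp p : ℂ) + (η : ℂ) * Complex.I‖ * tnorm η (p - r))) ≤
            (2 * 20736) * |Real.log η| ^ (3 : ℕ) := by
  rw [mul_assoc]
  apply final_bound hη hη1 α r _ 2 (by norm_num)
  · intro p; have := tnorm_pos hη (p - r); positivity
  · intro p hp
    have m1 : |α - edisp p| ≤ ‖(α : ℂ) - (edisp p : ℂ) + (η : ℂ) * Complex.I‖ := by
      have := Complex.abs_re_le_norm ((α : ℂ) - (edisp p : ℂ) + (η : ℂ) * Complex.I); simpa using this
    have m2 : η ≤ ‖(α : ℂ) - (edisp p : ℂ) + (η : ℂ) * Complex.I‖ := by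
      have := Complex.abs_im_le_norm ((α : ℂ) - (edisp p : ℂ) + (η : ℂ) * Complex.I)
      simp at this; exact (le_abs_self _).trans this
    exact ptwise (by linarith) (by positivity) (tnorm_pos hη _) (by linarith)

lemma part_two {κ : ℝ} (hκ : 0 < κ) {Θ : ℝ → ℂ} (h : IsThetaLimit Θ) {lam : ℝ} (hl : 0 < lam)
    (hl1 : lam ≤ 1/2) {η : ℝ} (hlη : η = lam ^ (2 + κ)) (α : ℝ) (r : Fin 3 → ℝ) :
    (∫ p in T3, 1 / (‖(α : ℂ) - omegaR Θ lam p + (η : ℂ) * Complex.I‖ * tnorm η (p - r))) ≤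
      ((2 + 4 * (144 * 96)) * 20736) * η ^ (-(κ/2)) * |Real.log η| ^ (3 : ℕ) := by
  have hη : 0 < η := by rw [hlη]; positivity
  have hη1 : η ≤ 1/2 := by
    calc η ≤ lam ^ (1 : ℝ) := by
          rw [hlη]; exact Real.rpow_le_rpow_of_exponent_ge hl (by linarith) (by linarith)
      _ ≤ 1/2 := by rw [Real.rpow_one]; exact hl1
  have hpow : lam ^ 2 / η ≤ η ^ (-(κ/2)) := by
    rw [hlη, ← Real.rpow_mul hl.le, ← Real.rpow_natCast, ← Real.rpow_sub hl]
    apply Real.rpow_le_rpow_of_exponent_ge hl (by linarith)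
    push_cast; nlinarith
  have hpow1 : 1 ≤ η ^ (-(κ/2)) := Real.one_le_rpow_of_pos_of_le_one_of_nonpos hη (by linarith) (by linarith)
  set B : ℝ := 4 * (144 * 96)
  have hB : 0 < B := by norm_num [B]
  have hfin := final_bound hη hη1 α r
    (fun p => 1 / (‖(α : ℂ) - omegaR Θ lam p + (η : ℂ) * Complex.I‖ * tnorm η (p - r)))
    ((2 + B) * η ^ (-(κ/2))) (by positivity) (fun p => by have := tnorm_pos hη (p - r); positivity) (by
      intro p hp
      obtain ⟨t1, t2⟩ := theta_bound h (edisp p)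
      set G := ‖(α : ℂ) - omegaR Θ lam p + (η : ℂ) * Complex.I‖ with hGdef
      have im_eq : ((α : ℂ) - omegaR Θ lam p + (η : ℂ) * Complex.I).im = η - lam ^ 2 * (Θ (edisp p)).im := by
        rw [omegaR, ← Complex.ofReal_pow]
        simp only [Complex.add_im, Complex.sub_im, Complex.ofReal_im, Complex.im_ofReal_mul, Complex.I_im]
        ring
      have re_eq : ((α : ℂ) - omegaR Θ lam p + (η : ℂ) * Complex.I).re = α - edisp p - lam ^ 2 * (Θ (edisp p)).re := by
        rw [omegaR, ← Complex.ofReal_pow]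
        simp only [Complex.add_re, Complex.sub_re, Complex.ofReal_re, Complex.re_ofReal_mul, Complex.I_re]
        ring
      have m2 : η ≤ G := by
        have := Complex.abs_im_le_norm ((α : ℂ) - omegaR Θ lam p + (η : ℂ) * Complex.I)
        rw [im_eq] at this
        have h' := le_abs_self (η - lam ^ 2 * (Θ (edisp p)).im)
        nlinarith [sq_nonneg lam]
      have m1 : |α - edisp p| ≤ G + lam ^ 2 * B := by
        have h1 := Complex.abs_re_le_norm ((α : ℂ) - omegaR Θ lam p + (η : ℂ) * Complex.I)
        rw [re_eq] at h1
        have h2 := (Complex.abs_re_le_norm (Θ (edisp p))).trans t1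
        calc |α - edisp p| = |(α - edisp p - lam ^ 2 * (Θ (edisp p)).re) + lam ^ 2 * (Θ (edisp p)).re| := by
              congr 1; ring
          _ ≤ |α - edisp p - lam ^ 2 * (Θ (edisp p)).re| + |lam ^ 2 * (Θ (edisp p)).re| := abs_add_le _ _
          _ ≤ G + lam ^ 2 * B := by
              rw [abs_mul, abs_of_nonneg (sq_nonneg lam)]
              gcongr
      have hG : 0 < G := by linarith
      apply ptwise hG (by positivity) (tnorm_pos hη _)
      have m3 : lam ^ 2 ≤ η ^ (-(κ/2)) * G := by
        calc lam ^ 2 = lam ^ 2 / η * η := by field_simp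
          _ ≤ η ^ (-(κ/2)) * G := by gcongr
      have m4 : G ≤ η ^ (-(κ/2)) * G := le_mul_of_one_le_left hG.le hpow1
      nlinarith)
  calc _ ≤ _ := hfin
    _ = _ := by ring

/-- (i) There is `c > 0` such that for all `0 < η ≤ 1/2`, all `α ∈ ℝ` and
all `r ∈ 𝕋³`, `∫ dp / (|α - e(p) + iη| |||p - r|||) ≤ c |log η|³`.
(ii) For every `κ > 0` there are `c > 0` and `λ₀ ∈ (0,1)` such that for `0 < λ ≤ λ₀`,
with `η = λ^{2+κ}`, all `α ∈ ℝ` and `r ∈ 𝕋³`,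
`∫ dp / (|α - ω(p) + iη| |||p - r|||) ≤ c η^{-κ/2} |log η|³`. -/
theorem statement15 :
    (∃ c : ℝ, 0 < c ∧
      ∀ η : ℝ, 0 < η → η ≤ 1/2 →
        ∀ α : ℝ, ∀ r : Fin 3 → ℝ,
          (∫ p in T3,
              1 / (‖(α : ℂ) - (edisp p : ℂ) + (η : ℂ) * Complex.I‖ * tnorm η (p - r))) ≤
            c * |Real.log η| ^ (3 : ℕ)) ∧
    (∀ κ : ℝ, 0 < κ →
      ∃ c lam0 : ℝ, 0 < c ∧ lam0 ∈ Set.Ioo (0 : ℝ) 1 ∧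
        ∀ Θ : ℝ → ℂ, IsThetaLimit Θ →
          ∀ lam : ℝ, 0 < lam → lam ≤ lam0 →
            ∀ η : ℝ, η = lam ^ (2 + κ) →
              ∀ α : ℝ, ∀ r : Fin 3 → ℝ,
                (∫ p in T3,
                    1 /
                      (‖(α : ℂ) - omegaR Θ lam p + (η : ℂ) * Complex.I‖ * tnorm η (p - r))) ≤
                  c * η ^ (-(κ/2)) * |Real.log η| ^ (3 : ℕ)) := by
  refine ⟨⟨2 * 20736, by norm_num, fun η hη hη1 α r => part_one hη hη1 α r⟩, fun κ hκ =>
    ⟨(2 + 4 * (144 * 96)) * 20736, 1/2, by norm_num, ⟨by norm_num, by norm_num⟩, ?_⟩⟩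
  intro Θ hΘ lam hl hl1 η hlη α r
  exact part_two hκ hΘ hl hl1 hlη α r

end
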